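/- arXiv:1008.1658 — 3 statements merged into one kernel-verified Lean document; each statement's English description precedes it below -/
import Mathlib

section
/- Let A be an SDTA over a finite alphabet Σ recognizing the tree language L, let b ∈ Σ, and let S be a finite set of finite tuples of Σ-trees. Assume that for any two distinct tuples (r_1,…,r_m), (s_1,…,s_n) ∈ S there exist a context t ∈ T_Σ[x] and Σ-trees u_1,…,u_k such that t(x←b(r_1,…,r_m,u_1,…,u_k)) ∈ L if and only if t(x←b(s_1,…,s_n,u_1,…,u_k)) ∉ L. Then the horizontal DFA H_b of A (the DFA associated with the symbol b) has at least |S| − 1 states. -/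
/-- Unranked trees over alphabet `α`: a node label together with a finite ordered
list of subtrees. -/
inductive UTree (α : Type) : Type where
  | node : α → List (UTree α) → UTree α

/-- Bottom-up reachability: `TReach δ t q` holds iff state `q` can be reached at the
root of tree `t` using the horizontal languages `δ`. -/
inductive TReach {α Q : Type} (δ : Q → α → Set (List Q)) : UTree α → Q → Prop where
  | node {a : α} {ts : List (UTree α)} {qs : List Q} {q : Q}
      (hlen : ts.length = qs.length)
      (hchild : ∀ i : Fin ts.length, TReach δ (ts.get i) (qs.get (Fin.cast hlen i)))
      (hq : qs ∈ δ q a) : TReach δ (UTree.node a ts) q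

/-- The tree language defined by transitions `δ` and final states `F`. -/
def TLang {α Q : Type} (δ : Q → α → Set (List Q)) (F : Set Q) : Set (UTree α) :=
  {t | ∃ q ∈ F, TReach δ t q}

/-- Contexts: unranked trees with exactly one leaf occurrence of a hole (the variable `x`). -/
inductive UCtx (α : Type) : Type where
  | hole : UCtx α
  | node : α → List (UTree α) → UCtx α → List (UTree α) → UCtx α

/-- Substituting a tree for the hole of a context. -/
def UCtx.subst {α : Type} : UCtx α → UTree α → UTree α
  | .hole, t => t
  | .node a l c r, t => UTree.node a (l ++ c.subst t :: r)

/-- Determinism of a tree automaton: the horizontal languages of distinct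
vertical states are disjoint. -/
def IsDet {α Q R : Type} (δ : Q → α → Set (List R)) : Prop :=
  ∀ (a : α) (q₁ q₂ : Q), q₁ ≠ q₂ → δ q₁ a ∩ δ q₂ a = ∅

/-! ### Plain (no leaf convention) models -/

/-- A strongly deterministic unranked tree automaton (SDTA): for each symbol `a` a
single complete DFA over the alphabet of vertical states, with final states `hacc a`
and output function `out a`. -/
structure SDTA (α : Type) where
  Q : Type
  [finQ : Fintype Q]
  S : α → Type
  [finS : ∀ a, Fintype (S a)]
  start : ∀ a : α, S a
  step : ∀ a : α, S a → Q → S a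
  hacc : ∀ a : α, Set (S a)
  out : ∀ a : α, S a → Q
  F : Set Q

attribute [instance] SDTA.finQ SDTA.finS

namespace SDTA
variable {α : Type} (A : SDTA α)

/-- Horizontal language `δ(q,a)` of an SDTA. -/
def hLang (q : A.Q) (a : α) : Set (List A.Q) :=
  {w | w.foldl (A.step a) (A.start a) ∈ A.hacc a ∧
       A.out a (w.foldl (A.step a) (A.start a)) = q}

/-- The tree language recognized by an SDTA. -/
def lang : Set (UTree α) := TLang A.hLang A.F

/-- Number of vertical states. -/
def vcard : ℕ := Fintype.card A.Q

/-- Number of horizontal states: `Σ_{σ∈Σ} |S_σ|`. -/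
def hcard [Fintype α] : ℕ := ∑ a : α, Fintype.card (A.S a)

end SDTA

/-- An NTA(NFA): an unranked tree automaton whose horizontal language for each
vertical state `q` and symbol `a` is given by an NFA over the alphabet of vertical
states. -/
structure NTAN (α : Type) where
  Q : Type
  [finQ : Fintype Q]
  S : Q → α → Type
  [finS : ∀ q a, Fintype (S q a)]
  H : ∀ (q : Q) (a : α), NFA Q (S q a)
  F : Set Q

attribute [instance] NTAN.finQ NTAN.finS

namespace NTAN
variable {α : Type} (A : NTAN α)

/-- Horizontal language `δ(q,a)`. -/
def hLang (q : A.Q) (a : α) : Set (List A.Q) := (A.H q a).accepts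

/-- The tree language recognized. -/
def lang : Set (UTree α) := TLang A.hLang A.F

/-- Number of vertical states. -/
def vcard : ℕ := Fintype.card A.Q

/-- Number of horizontal states: `Σ_{q∈Q,σ∈Σ} |S_{q,σ}|`. -/
def hcard [Fintype α] : ℕ := ∑ q : A.Q, ∑ a : α, Fintype.card (A.S q a)

/-- A DTA(NFA) is an NTA(NFA) that is deterministic. -/
def IsDTA : Prop := IsDet A.hLang

end NTAN

/-- An NTA(DFA): an unranked tree automaton whose horizontal language for each
vertical state `q` and symbol `a` is given by a complete DFA over the alphabet of
vertical states. -/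
structure NTAD (α : Type) where
  Q : Type
  [finQ : Fintype Q]
  S : Q → α → Type
  [finS : ∀ q a, Fintype (S q a)]
  H : ∀ (q : Q) (a : α), DFA Q (S q a)
  F : Set Q

attribute [instance] NTAD.finQ NTAD.finS

namespace NTAD
variable {α : Type} (A : NTAD α)

/-- Horizontal language `δ(q,a)`. -/
def hLang (q : A.Q) (a : α) : Set (List A.Q) := (A.H q a).accepts

/-- The tree language recognized. -/
def lang : Set (UTree α) := TLang A.hLang A.F

/-- Number of vertical states. -/
def vcard : ℕ := Fintype.card A.Q

/-- Number of horizontal states: `Σ_{q∈Q,σ∈Σ} |S_{q,σ}|`. -/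
def hcard [Fintype α] : ℕ := ∑ q : A.Q, ∑ a : α, Fintype.card (A.S q a)

/-- A DTA(DFA) is an NTA(DFA) that is deterministic. -/
def IsDTA : Prop := IsDet A.hLang

end NTAD

/-! ### Models with the leaf convention

Under the leaf convention, every leaf labelled `σ` is assigned a special
state `σ̄` used nowhere else: `δ(σ̄,σ) = {ε}`, `ε ∉ δ(q,σ)` for counted vertical
states `q`, and `δ(τ̄,σ) = ∅` for `τ ≠ σ`.  The full vertical state set is
`Q ⊕ α`, where only the states in `Q` (and only the horizontal automata attached
to them) are counted. -/

/-- Extension of horizontal languages (given on the counted states `Q`) to the full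
state set `Q ⊕ α` by the leaf convention. -/
def leafδ {α Q : Type} (δ : Q → α → Set (List (Q ⊕ α))) :
    Q ⊕ α → α → Set (List (Q ⊕ α))
  | Sum.inl q, a => δ q a
  | Sum.inr τ, a => {w | τ = a ∧ w = []}

/-- An SDTA observing the leaf convention. -/
structure CSDTA (α : Type) where
  Q : Type
  [finQ : Fintype Q]
  S : α → Type
  [finS : ∀ a, Fintype (S a)]
  start : ∀ a : α, S a
  step : ∀ a : α, S a → Q ⊕ α → S a
  hacc : ∀ a : α, Set (S a)
  out : ∀ a : α, S a → Q
  F : Set (Q ⊕ α)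
  noeps : ∀ a : α, start a ∉ hacc a

attribute [instance] CSDTA.finQ CSDTA.finS

namespace CSDTA
variable {α : Type} (A : CSDTA α)

/-- Horizontal language `δ(q,a)` for a counted vertical state `q`. -/
def hLang (q : A.Q) (a : α) : Set (List (A.Q ⊕ α)) :=
  {w | w.foldl (A.step a) (A.start a) ∈ A.hacc a ∧
       A.out a (w.foldl (A.step a) (A.start a)) = q}

/-- The tree language recognized. -/
def lang : Set (UTree α) := TLang (leafδ A.hLang) A.F

/-- Number of (counted) vertical states. -/
def vcard : ℕ := Fintype.card A.Q

/-- Number of horizontal states: `Σ_{σ∈Σ} |S_σ|`. -/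
def hcard [Fintype α] : ℕ := ∑ a : α, Fintype.card (A.S a)

end CSDTA

/-- An NTA(DFA) observing the leaf convention. -/
structure CNTAD (α : Type) where
  Q : Type
  [finQ : Fintype Q]
  S : Q → α → Type
  [finS : ∀ q a, Fintype (S q a)]
  H : ∀ (q : Q) (a : α), DFA (Q ⊕ α) (S q a)
  F : Set (Q ⊕ α)
  noeps : ∀ (q : Q) (a : α), [] ∉ (H q a).accepts

attribute [instance] CNTAD.finQ CNTAD.finS

namespace CNTAD
variable {α : Type} (A : CNTAD α)

/-- Horizontal language `δ(q,a)` for a counted vertical state `q`. -/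
def hLang (q : A.Q) (a : α) : Set (List (A.Q ⊕ α)) := (A.H q a).accepts

/-- The tree language recognized. -/
def lang : Set (UTree α) := TLang (leafδ A.hLang) A.F

/-- Number of (counted) vertical states. -/
def vcard : ℕ := Fintype.card A.Q

/-- Number of horizontal states: `Σ_{q∈Q,σ∈Σ} |S_{q,σ}|`. -/
def hcard [Fintype α] : ℕ := ∑ q : A.Q, ∑ a : α, Fintype.card (A.S q a)

/-- A DTA(DFA) with the leaf convention is a CNTAD that is deterministic. -/
def IsDTA : Prop := IsDet A.hLang

end CNTAD

/-- An NTA(NFA) observing the leaf convention. -/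
structure CNTAN (α : Type) where
  Q : Type
  [finQ : Fintype Q]
  S : Q → α → Type
  [finS : ∀ q a, Fintype (S q a)]
  H : ∀ (q : Q) (a : α), NFA (Q ⊕ α) (S q a)
  F : Set (Q ⊕ α)
  noeps : ∀ (q : Q) (a : α), [] ∉ (H q a).accepts

attribute [instance] CNTAN.finQ CNTAN.finS

namespace CNTAN
variable {α : Type} (A : CNTAN α)

/-- Horizontal language `δ(q,a)` for a counted vertical state `q`. -/
def hLang (q : A.Q) (a : α) : Set (List (A.Q ⊕ α)) := (A.H q a).accepts

/-- The tree language recognized. -/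
def lang : Set (UTree α) := TLang (leafδ A.hLang) A.F

/-- Number of (counted) vertical states. -/
def vcard : ℕ := Fintype.card A.Q

/-- Number of horizontal states: `Σ_{q∈Q,σ∈Σ} |S_{q,σ}|`. -/
def hcard [Fintype α] : ℕ := ∑ q : A.Q, ∑ a : α, Fintype.card (A.S q a)

/-- A DTA(NFA) with the leaf convention is a CNTAN that is deterministic. -/
def IsDTA : Prop := IsDet A.hLang

end CNTAN


theorem List.forall₂_append_left_iff {α β : Type*} {R : α → β → Prop} {l₁ l₂ : List α}
    {l : List β} : List.Forall₂ R (l₁ ++ l₂) l ↔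
      ∃ m₁ m₂, List.Forall₂ R l₁ m₁ ∧ List.Forall₂ R l₂ m₂ ∧ l = m₁ ++ m₂ := by
  constructor
  · induction l₁ generalizing l with
    | nil => exact fun h => ⟨[], l, .nil, h, rfl⟩
    | cons a l₁ ih =>
      rintro (_ | ⟨hab, h⟩)
      obtain ⟨m₁, m₂, h₁, h₂, rfl⟩ := ih h
      exact ⟨_ :: m₁, m₂, .cons hab h₁, h₂, rfl⟩
  · rintro ⟨m₁, m₂, h₁, h₂, rfl⟩
    exact List.rel_append h₁ h₂

theorem treach_node_iff {α Q : Type} {δ : Q → α → Set (List Q)} {a : α}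
    {ts : List (UTree α)} {q : Q} :
    TReach δ (UTree.node a ts) q ↔ ∃ qs, List.Forall₂ (TReach δ) ts qs ∧ qs ∈ δ q a := by
  constructor
  · rintro ⟨hlen, hchild, hq⟩
    exact ⟨_, List.forall₂_iff_get.2 ⟨hlen, fun i hi _ => hchild ⟨i, hi⟩⟩, hq⟩
  · rintro ⟨qs, hqs, hq⟩
    obtain ⟨hlen, hget⟩ := List.forall₂_iff_get.1 hqs
    exact .node hlen (fun i => hget i i.2 (hlen ▸ i.2)) hq

theorem treach_subst_congr {α Q : Type} {δ : Q → α → Set (List Q)} {t t' : UTree α}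
    (h : ∀ q, TReach δ t q ↔ TReach δ t' q) (c : UCtx α) (q : Q) :
    TReach δ (c.subst t) q ↔ TReach δ (c.subst t') q := by
  induction c generalizing q with
  | hole => exact h q
  | node a l c r ih =>
    simp only [UCtx.subst, treach_node_iff, List.forall₂_append_left_iff,
      List.forall₂_cons_left_iff, ih]

theorem mem_tLang_subst_congr {α Q : Type} {δ : Q → α → Set (List Q)} {F : Set Q}
    {t t' : UTree α} (h : ∀ q, TReach δ t q ↔ TReach δ t' q) (c : UCtx α) :
    c.subst t ∈ TLang δ F ↔ c.subst t' ∈ TLang δ F := by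
  simp only [TLang, Set.mem_ofPred_eq, treach_subst_congr h c]

namespace SDTA
variable {α : Type} (A : SDTA α)

/-- An SDTA reaches at most one state at the root of a tree. -/
theorem treach_rightUnique : Relator.RightUnique (TReach A.hLang) := by
  intro t q q' h
  induction h generalizing q' with
  | @node a ts qs q hlen _ hq ih =>
    intro h'
    cases h' with
    | @node _ _ qs' _ hlen' hchild' hq' =>
      have hqs : qs = qs' := List.ext_getElem (hlen.symm.trans hlen') fun i hi _ =>
        ih ⟨i, hlen ▸ hi⟩ (hchild' ⟨i, hlen ▸ hi⟩)
      subst hqs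
      exact hq.2.symm.trans hq'.2

open Classical in
/-- The state of the horizontal DFA of `b` after reading the states reached at the trees
`ts`, or `none` if some of these trees does not reach a state. -/
noncomputable def hstate (b : α) (ts : List (UTree α)) : Option (A.S b) :=
  if h : ∃ qs, List.Forall₂ (TReach A.hLang) ts qs then
    some (h.choose.foldl (A.step b) (A.start b))
  else none

theorem hstate_eq_some_iff {b : α} {ts : List (UTree α)} {s : A.S b} :
    A.hstate b ts = some s ↔
      ∃ qs, List.Forall₂ (TReach A.hLang) ts qs ∧ qs.foldl (A.step b) (A.start b) = s := by
  unfold hstate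
  split_ifs with h
  · rw [Option.some_inj]
    refine ⟨fun hs => ⟨_, h.choose_spec, hs⟩, ?_⟩
    rintro ⟨qs, hqs, hs⟩
    rwa [Relator.RightUnique.forall₂ A.treach_rightUnique h.choose_spec hqs]
  · simp only [false_iff]
    rintro ⟨qs, hqs, -⟩
    exact h ⟨qs, hqs⟩

theorem treach_node_append_iff {b : α} {ts u : List (UTree α)} {q : A.Q} :
    TReach A.hLang (UTree.node b (ts ++ u)) q ↔
      ∃ s, A.hstate b ts = some s ∧ ∃ us, List.Forall₂ (TReach A.hLang) u us ∧
        us.foldl (A.step b) s ∈ A.hacc b ∧ A.out b (us.foldl (A.step b) s) = q := by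
  rw [treach_node_iff]
  constructor
  · rintro ⟨qs, hqs, hq⟩
    obtain ⟨ps, us, hps, hus, rfl⟩ := List.forall₂_append_left_iff.1 hqs
    simp only [hLang, Set.mem_ofPred_eq, List.foldl_append] at hq
    exact ⟨_, A.hstate_eq_some_iff.2 ⟨ps, hps, rfl⟩, us, hus, hq⟩
  · rintro ⟨s, hs, us, hus, hq⟩
    obtain ⟨ps, hps, rfl⟩ := A.hstate_eq_some_iff.1 hs
    refine ⟨ps ++ us, List.rel_append hps hus, ?_⟩
    simpa only [hLang, Set.mem_ofPred_eq, List.foldl_append] using hq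

end SDTA

/-- if `A` is an SDTA recognizing `L`, `b` a symbol, and
`S = {r_1, …, r_N}` a set of pairwise distinct tuples of trees such that any two
distinct tuples can be separated by a context together with a common suffix of
trees placed below a `b`-labelled node, then the horizontal DFA `H_b` of `A`
has at least `N - 1` states. -/
theorem statement1 (α : Type) (A : SDTA α) (b : α) (N : ℕ)
    (r : Fin N → List (UTree α)) (hinj : Function.Injective r)
    (h : ∀ i j : Fin N, i ≠ j → ∃ (c : UCtx α) (u : List (UTree α)),
      (c.subst (UTree.node b (r i ++ u)) ∈ A.lang ↔
       c.subst (UTree.node b (r j ++ u)) ∉ A.lang)) :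
    N - 1 ≤ Fintype.card (A.S b) := by
  have hf : Function.Injective fun i => A.hstate b (r i) := by
    intro i j hij
    by_contra hne
    obtain ⟨c, u, hcu⟩ := h i j hne
    have hreach : ∀ q, TReach A.hLang (UTree.node b (r i ++ u)) q ↔
        TReach A.hLang (UTree.node b (r j ++ u)) q := by
      intro q
      simp only [A.treach_node_append_iff, show A.hstate b (r i) = A.hstate b (r j) from hij]
    have hmem : c.subst (UTree.node b (r i ++ u)) ∈ A.lang ↔
        c.subst (UTree.node b (r j ++ u)) ∈ A.lang := mem_tLang_subst_congr hreach c
    tauto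
  have hcard := Fintype.card_le_of_injective _ hf
  rw [Fintype.card_fin, Fintype.card_option] at hcard
  omega
end

section
/- Let A = (Q, Σ, δ, F) be an NTA(NFA) and for q ∈ Q, σ ∈ Σ let m_{q,σ} be the number of states of the NFA H^A_{q,σ} recognizing δ(q,σ). Then there exists an SDTA B equivalent to A (i.e., L(B) = L(A)) with at most 2^{|Q|} vertical states and at most Σ_{σ∈Σ} 2^{(Σ_{q∈Q} m_{q,σ})} horizontal states. -/
/-- Induction on unranked trees, with the hypothesis for all immediate subtrees. -/
theorem UTree.induction {α : Type} {p : UTree α → Prop}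
    (h : ∀ a ts, (∀ t ∈ ts, p t) → p (.node a ts)) : ∀ t, p t
  | .node a ts => h a ts fun t ht =>
      have := List.sizeOf_lt_of_mem ht
      UTree.induction h t
termination_by t => sizeOf t

theorem tReach_node_iff {α Q : Type} {δ : Q → α → Set (List Q)} {a : α}
    {ts : List (UTree α)} {q : Q} :
    TReach δ (.node a ts) q ↔ ∃ qs, List.Forall₂ (TReach δ) ts qs ∧ qs ∈ δ q a := by
  constructor
  · rintro ⟨hlen, hchild, hq⟩
    exact ⟨_, List.forall₂_iff_get.2 ⟨hlen, fun i hi _ => hchild ⟨i, hi⟩⟩, hq⟩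
  · rintro ⟨qs, h, hq⟩
    obtain ⟨hlen, h⟩ := List.forall₂_iff_get.1 h
    exact .node hlen (fun i => h i i.2 (hlen ▸ i.2)) hq

/-- A relation that is the graph of `f` on the members of `l` is satisfied pointwise exactly by
the image of `l` under `f`. -/
theorem List.forall₂_iff_eq_map_of_forall_mem {β γ : Type*} {R : β → γ → Prop} {f : β → γ}
    {l : List β} (h : ∀ x ∈ l, ∀ y, R x y ↔ y = f x) {l' : List γ} :
    List.Forall₂ R l l' ↔ l' = l.map f := by
  induction l generalizing l' with
  | nil => simp
  | cons x l ih =>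
    rw [List.forall₂_cons_left_iff, List.map_cons]
    simp only [h x mem_cons_self, ih fun y hy => h y (mem_cons_of_mem x hy)]
    grind

namespace NTAN
variable {α : Type} (A : NTAN α)

open scoped Classical in
/-- The subset construction, applied simultaneously to the vertical states and, for each symbol,
to the product of all horizontal automata. -/
noncomputable abbrev toSDTA : SDTA α where
  Q := Set A.Q
  S a := ∀ q, Set (A.S q a)
  start a q := (A.H q a).start
  step a f P q := ⋃ p ∈ P, (A.H q a).stepSet (f q) p
  hacc _ := Set.univ
  out a f := {q | ∃ s ∈ (A.H q a).accept, s ∈ f q}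
  F := {P | ∃ q ∈ A.F, q ∈ P}

theorem mem_foldl_toSDTA_step {a : α} {q : A.Q} {s : A.S q a} (Ps : List (Set A.Q))
    (f : ∀ q, Set (A.S q a)) :
    s ∈ (Ps.foldl (A.toSDTA.step a) f : ∀ q, Set (A.S q a)) q ↔
      ∃ qs, List.Forall₂ (fun P q => q ∈ P) Ps qs ∧ s ∈ (A.H q a).evalFrom (f q) qs := by
  induction Ps generalizing f with
  | nil => simp
  | cons P Ps ih =>
    refine (ih (A.toSDTA.step a f P)).trans ?_
    simp only [NFA.evalFrom_iUnion₂, Set.mem_iUnion, List.forall₂_cons_left_iff]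
    constructor
    · rintro ⟨qs, hqs, p, hp, hs⟩
      exact ⟨p :: qs, ⟨p, qs, hp, hqs, rfl⟩, hs⟩
    · rintro ⟨_, ⟨p, qs, hp, hqs, rfl⟩, hs⟩
      exact ⟨qs, hqs, p, hp, hs⟩

theorem mem_toSDTA_hLang_iff {a : α} {Ps : List (Set A.Q)} {P : Set A.Q} :
    Ps ∈ A.toSDTA.hLang P a ↔
      P = {q | ∃ qs, List.Forall₂ (fun P q => q ∈ P) Ps qs ∧ qs ∈ A.hLang q a} := by
  have key : A.toSDTA.out a (Ps.foldl (A.toSDTA.step a) (A.toSDTA.start a)) =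
      {q | ∃ qs, List.Forall₂ (fun P q => q ∈ P) Ps qs ∧ qs ∈ A.hLang q a} := by
    ext q
    constructor
    · rintro ⟨s, hs, h⟩
      obtain ⟨qs, hqs, h⟩ := (A.mem_foldl_toSDTA_step Ps _).1 h
      exact ⟨qs, hqs, s, hs, h⟩
    · rintro ⟨qs, hqs, s, hs, h⟩
      exact ⟨s, hs, (A.mem_foldl_toSDTA_step Ps _).2 ⟨qs, hqs, h⟩⟩
  rw [← key]
  exact ⟨fun h => h.2.symm, fun h => ⟨trivial, h.symm⟩⟩

theorem tReach_toSDTA_iff (t : UTree α) (P : Set A.Q) :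
    TReach A.toSDTA.hLang t P ↔ P = {q | TReach A.hLang t q} := by
  induction t using UTree.induction generalizing P with
  | h a ts ih =>
    have hmap (Ps : List (Set A.Q)) : List.Forall₂ (TReach A.toSDTA.hLang) ts Ps ↔
        Ps = ts.map fun t => {q | TReach A.hLang t q} :=
      List.forall₂_iff_eq_map_of_forall_mem ih
    rw [tReach_node_iff]
    refine (exists_congr fun Ps => and_congr (hmap Ps) A.mem_toSDTA_hLang_iff).trans ?_
    simp [tReach_node_iff, List.forall₂_map_left_iff]

theorem lang_toSDTA : A.toSDTA.lang = A.lang := by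
  ext t
  constructor
  · rintro ⟨P, ⟨q, hq, hP⟩, h⟩
    rw [tReach_toSDTA_iff] at h
    subst h
    exact ⟨q, hq, hP⟩
  · rintro ⟨q, hq, h⟩
    exact ⟨_, ⟨q, hq, h⟩, (A.tReach_toSDTA_iff t _).2 rfl⟩

theorem vcard_toSDTA : A.toSDTA.vcard = 2 ^ A.vcard := by
  classical
  simp only [SDTA.vcard, vcard, ← Nat.card_eq_fintype_card]
  exact (Nat.card_eq_fintype_card (α := Set A.Q)).trans (by simp)

theorem hcard_toSDTA [Fintype α] :
    A.toSDTA.hcard = ∑ a : α, 2 ^ (∑ q : A.Q, Fintype.card (A.S q a)) := by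
  classical
  refine Finset.sum_congr rfl fun a _ => ?_
  rw [← Nat.card_eq_fintype_card]
  exact (Nat.card_eq_fintype_card (α := ∀ q, Set (A.S q a))).trans
    (by simp [Finset.prod_pow_eq_pow_sum])

end NTAN

/-- every NTA(NFA) `A` has an equivalent SDTA with at most
`2^{|Q|}` vertical states and at most `Σ_σ 2^{Σ_q m_{q,σ}}` horizontal states. -/
theorem statement9 (α : Type) [Fintype α] (A : NTAN α) :
    ∃ B : SDTA α, B.lang = A.lang ∧ B.vcard ≤ 2 ^ A.vcard ∧
      B.hcard ≤ ∑ a : α, 2 ^ (∑ q : A.Q, Fintype.card (A.S q a)) := by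
  exact ⟨A.toSDTA, A.lang_toSDTA, A.vcard_toSDTA.le, A.hcard_toSDTA.le⟩
end

section
/- For every n ≥ 1 and all pairwise relatively prime integers 2 ≤ m_1 < m_2 < … < m_n, there exists a tree language L over Σ = {a, b} recognized by an NTA(DFA) A with at most n vertical states and at most (Σ_{i=1}^n m_i) + 2n − 2 horizontal states, such that every SDTA recognizing L has at least 2^n − 1 vertical states and at least (∏_{i=1}^n m_i) − 1 horizontal states. -/
/-! ### Reachability -/

theorem TReach.node_iff {α Q : Type} {δ : Q → α → Set (List Q)} {a : α}
    {ts : List (UTree α)} {q : Q} :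
    TReach δ (UTree.node a ts) q ↔ ∃ qs ∈ δ q a, List.Forall₂ (TReach δ) ts qs := by
  constructor
  · rintro (⟨hlen, hchild, hq⟩)
    refine ⟨_, hq, List.forall₂_iff_get.2 ⟨hlen, fun i h₁ h₂ => ?_⟩⟩
    exact hchild ⟨i, h₁⟩
  · rintro ⟨qs, hq, h⟩
    obtain ⟨hlen, h⟩ := List.forall₂_iff_get.1 h
    exact TReach.node hlen (fun i => h i i.2 (hlen ▸ i.2)) hq

theorem TReach.singleton_iff {α Q : Type} {δ : Q → α → Set (List Q)} {a : α}
    {t : UTree α} {q : Q} :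
    TReach δ (UTree.node a [t]) q ↔ ∃ p, TReach δ t p ∧ [p] ∈ δ q a := by
  rw [TReach.node_iff]
  constructor
  · rintro ⟨qs, hq, h⟩
    cases h with
    | cons h h' => cases h'; exact ⟨_, h, hq⟩
  · rintro ⟨p, hp, hq⟩
    exact ⟨[p], hq, .cons hp .nil⟩

theorem TReach.leaf_iff {α Q : Type} {δ : Q → α → Set (List Q)} {a : α} {q : Q} :
    TReach δ (UTree.node a []) q ↔ [] ∈ δ q a := by
  simp [TReach.node_iff]

theorem List.forall₂_replicate_of_unique {α β : Type} {R : α → β → Prop} {x : α} {y : β}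
    (h : ∀ z, R x z ↔ z = y) (k : ℕ) (l : List β) :
    List.Forall₂ R (List.replicate k x) l ↔ l = List.replicate k y := by
  induction k generalizing l with
  | zero => simp
  | succ k ih => cases l <;> simp [List.replicate_succ, h, ih]

/-- If `x` reaches exactly `p`, then a node above `k` copies of `x` reads the word `p ^ k`. -/
theorem TReach.replicate_iff {α Q : Type} {δ : Q → α → Set (List Q)} {a : α}
    {x : UTree α} {p q : Q} (h : ∀ z, TReach δ x z ↔ z = p) (k : ℕ) :
    TReach δ (UTree.node a (List.replicate k x)) q ↔ List.replicate k p ∈ δ q a := by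
  simp [TReach.node_iff, List.forall₂_replicate_of_unique h]

/-- The tree with root labelled `0` and `k` leaf children labelled `1`. -/
def broom (k : ℕ) : UTree (Fin 2) := UTree.node 0 (List.replicate k (UTree.node 1 []))

/-- Put `j` unary nodes labelled `0` on top of a tree. -/
def tower (j : ℕ) (t : UTree (Fin 2)) : UTree (Fin 2) := (fun s => UTree.node 0 [s])^[j] t

theorem tower_succ (j : ℕ) (t : UTree (Fin 2)) :
    tower (j + 1) t = UTree.node 0 [tower j t] :=
  Function.iterate_succ_apply' _ _ _

theorem TReach.tower_congr {Q : Type} {δ : Q → Fin 2 → Set (List Q)} {t t' : UTree (Fin 2)}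
    (h : ∀ q, TReach δ t q ↔ TReach δ t' q) (j : ℕ) (q : Q) :
    TReach δ (tower j t) q ↔ TReach δ (tower j t') q := by
  induction j generalizing q with
  | zero => exact h q
  | succ j ih => simp only [tower_succ, TReach.singleton_iff, ih]

theorem TReach.exists_of_tower {Q : Type} {δ : Q → Fin 2 → Set (List Q)} {t : UTree (Fin 2)}
    {j : ℕ} {q : Q} (h : TReach δ (tower j t) q) : ∃ p, TReach δ t p := by
  induction j generalizing q with
  | zero => exact ⟨q, h⟩
  | succ j ih =>
    rw [tower_succ, TReach.singleton_iff] at h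
    obtain ⟨p, hp, -⟩ := h
    exact ih hp

theorem TLang.tower_congr {Q : Type} {δ : Q → Fin 2 → Set (List Q)} {F : Set Q}
    {t t' : UTree (Fin 2)} (h : ∀ q, TReach δ t q ↔ TReach δ t' q) (j : ℕ) :
    tower j t ∈ TLang δ F ↔ tower j t' ∈ TLang δ F := by
  simp only [TLang, Set.mem_ofPred_eq, TReach.tower_congr h]

/-! ### Strongly deterministic automata -/

namespace CSDTA

theorem reach_leaf_iff {α : Type} (B : CSDTA α) (a : α) (z : B.Q ⊕ α) :
    TReach (leafδ B.hLang) (UTree.node a []) z ↔ z = Sum.inr a := by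
  rw [TReach.leaf_iff]
  cases z with
  | inl q =>
    simp only [leafδ, hLang, Set.mem_ofPred_eq, List.foldl_nil, reduceCtorEq, iff_false, not_and]
    exact fun h => absurd h (B.noeps a)
  | inr b => simp [leafδ]

variable (B : CSDTA (Fin 2))

/-- The horizontal state reached after reading `k` leaves labelled `1` below the label `0`. -/
def leafRun (k : ℕ) : B.S 0 :=
  (List.replicate k (Sum.inr 1)).foldl (B.step 0) (B.start 0)

theorem leafRun_add (k j : ℕ) :
    B.leafRun (k + j) = (List.replicate j (Sum.inr 1)).foldl (B.step 0) (B.leafRun k) := by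
  rw [leafRun, List.replicate_add, List.foldl_append, leafRun]

theorem reach_broom_iff {k : ℕ} (hk : k ≠ 0) (z : B.Q ⊕ Fin 2) :
    TReach (leafδ B.hLang) (broom k) z ↔
      B.leafRun k ∈ B.hacc 0 ∧ z = Sum.inl (B.out 0 (B.leafRun k)) := by
  rw [broom, TReach.replicate_iff (B.reach_leaf_iff 1)]
  cases z with
  | inl q => simp [leafδ, hLang, leafRun, eq_comm]
  | inr b => simp [leafδ, hk]

theorem tower_broom_mem_iff_of_leafRun_eq {k l : ℕ} (hk : k ≠ 0) (hl : l ≠ 0)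
    (h : B.leafRun k = B.leafRun l) (j : ℕ) :
    tower j (broom k) ∈ B.lang ↔ tower j (broom l) ∈ B.lang :=
  TLang.tower_congr (fun z => by rw [B.reach_broom_iff hk, B.reach_broom_iff hl, h]) j

theorem tower_broom_mem_iff_of_out_eq {k l : ℕ} (hk : k ≠ 0) (hl : l ≠ 0)
    (hka : B.leafRun k ∈ B.hacc 0) (hla : B.leafRun l ∈ B.hacc 0)
    (h : B.out 0 (B.leafRun k) = B.out 0 (B.leafRun l)) (j : ℕ) :
    tower j (broom k) ∈ B.lang ↔ tower j (broom l) ∈ B.lang :=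
  TLang.tower_congr
    (fun z => by rw [B.reach_broom_iff hk, B.reach_broom_iff hl, h]; simp [hka, hla]) j

theorem leafRun_mem_hacc {k j : ℕ} (hk : k ≠ 0) (h : tower j (broom k) ∈ B.lang) :
    B.leafRun k ∈ B.hacc 0 := by
  obtain ⟨q, -, hq⟩ := h
  obtain ⟨p, hp⟩ := hq.exists_of_tower
  exact ((B.reach_broom_iff hk p).1 hp).1

theorem card_S_le_hcard (a : Fin 2) : Fintype.card (B.S a) ≤ B.hcard :=
  Finset.single_le_sum (f := fun a => Fintype.card (B.S a)) (fun _ _ => Nat.zero_le _)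
    (Finset.mem_univ a)

theorem one_le_hcard : 1 ≤ B.hcard :=
  (Fintype.card_pos_iff.2 ⟨B.start 0⟩).trans_le (B.card_S_le_hcard 0)

theorem one_le_vcard : 1 ≤ B.vcard :=
  Fintype.card_pos_iff.2 ⟨B.out 0 (B.start 0)⟩

section LowerBounds

variable {n : ℕ} {m : Fin n → ℕ}

theorem prod_le_hcard (hm2 : ∀ i, 2 ≤ m i)
    (hcop : ∀ i j, i ≠ j → Nat.Coprime (m i) (m j))
    (hB : ∀ k, k ≠ 0 → ∀ i : Fin n, tower i (broom k) ∈ B.lang ↔ k ≡ 1 [MOD m i]) :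
    ∏ i, m i ≤ B.hcard := by
  refine le_trans ?_ (B.card_S_le_hcard 0)
  have hinj : Function.Injective (fun k : Fin (∏ i, m i) => B.leafRun k) := by
    intro k l hkl
    have hmod : ∀ i, (k : ℕ) ≡ l [MOD m i] := by
      intro i
      obtain ⟨c, hc⟩ : ∃ c, m i = c + 1 := ⟨m i - 1, by have := hm2 i; omega⟩
      have hk : (k : ℕ) + (c * k + 1) ≡ 1 [MOD m i] := by
        rw [show (k : ℕ) + (c * k + 1) = m i * k + 1 by rw [hc]; ring]
        simp [Nat.ModEq]
      have hrun : B.leafRun (k + (c * k + 1)) = B.leafRun (l + (c * k + 1)) := by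
        rw [leafRun_add, leafRun_add]
        exact congrArg (List.foldl (B.step 0) · (List.replicate (c * k + 1) (Sum.inr 1))) hkl
      have hl := (hB _ (by omega) i).1
        ((B.tower_broom_mem_iff_of_leafRun_eq (by omega) (by omega) hrun i).1
          ((hB _ (by omega) i).2 hk))
      exact Nat.ModEq.add_right_cancel' _ (hk.trans hl.symm)
    have hdvd : ((∏ i, m i : ℕ) : ℤ) ∣ (l : ℤ) - k := by
      push_cast
      refine Fintype.prod_dvd_of_coprime (fun i j hij => ?_) fun i => (hmod i).dvd
      exact Nat.isCoprime_iff_coprime.2 (hcop i j hij)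
    have := (Nat.modEq_iff_dvd.2 hdvd).eq_of_lt_of_lt k.2 l.2
    exact Fin.ext this
  simpa using Fintype.card_le_of_injective _ hinj

theorem two_pow_sub_one_le_vcard (hm2 : ∀ i, 2 ≤ m i)
    (hcop : ∀ i j, i ≠ j → Nat.Coprime (m i) (m j))
    (hB : ∀ k, k ≠ 0 → ∀ i : Fin n, tower i (broom k) ∈ B.lang ↔ k ≡ 1 [MOD m i]) :
    2 ^ n - 1 ≤ B.vcard := by
  have hcrt : ∀ T : Finset (Fin n), ∃ k : ℕ, ∀ i, k ≡ 1 [MOD m i] ↔ i ∈ T := by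
    intro T
    obtain ⟨k, hk⟩ := Nat.chineseRemainderOfFinset (fun i => if i ∈ T then 1 else 0) m
      Finset.univ (fun i _ => by have := hm2 i; omega) (fun i _ j _ hij => hcop i j hij)
    refine ⟨k, fun i => ?_⟩
    have hki := hk i (Finset.mem_univ i)
    by_cases hi : i ∈ T
    · simpa [hi] using hki
    · simp only [hi, if_false, iff_false] at hki ⊢
      intro h
      have h01 : 0 ≡ 1 [MOD m i] := hki.symm.trans h
      have := hm2 i
      have := h01.eq_of_lt_of_lt (by omega) (by omega)
      omega
  choose k hk using hcrt
  have hne : ∀ T : Finset (Fin n), T.Nonempty → k T ≠ 0 := by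
    rintro T ⟨i, hi⟩ h0
    have h01 := (hk T i).2 hi
    rw [h0] at h01
    have := hm2 i
    have := h01.eq_of_lt_of_lt (by omega) (by omega)
    omega
  have hacc : ∀ T : Finset (Fin n), T.Nonempty → B.leafRun (k T) ∈ B.hacc 0 := by
    intro T hT
    obtain ⟨i, hi⟩ := hT
    exact B.leafRun_mem_hacc (hne T ⟨i, hi⟩) ((hB _ (hne T ⟨i, hi⟩) i).2 ((hk T i).2 hi))
  have hcard : (Finset.univ.erase (∅ : Finset (Fin n))).card = 2 ^ n - 1 := by
    rw [Finset.card_erase_of_mem (Finset.mem_univ _)]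
    simp
  rw [← hcard, vcard, ← Finset.card_univ]
  refine Finset.card_le_card_of_injOn (fun T => B.out 0 (B.leafRun (k T)))
    (fun _ _ => Finset.mem_coe.2 (Finset.mem_univ _)) ?_
  intro T hT U hU hTU
  have hT' : T.Nonempty := Finset.nonempty_iff_ne_empty.2 (by simpa using hT)
  have hU' : U.Nonempty := Finset.nonempty_iff_ne_empty.2 (by simpa using hU)
  ext i
  rw [← hk T i, ← hk U i, ← hB _ (hne T hT') i, ← hB _ (hne U hU') i]
  exact B.tower_broom_mem_iff_of_out_eq (hne T hT') (hne U hU') (hacc T hT') (hacc U hU') hTU i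

end LowerBounds

end CSDTA

/-! ### The nondeterministic automaton -/

/-- Lengths of the counting cycles: only the label `0` needs a nontrivial automaton. -/
def cycleSize {n : ℕ} (m : Fin n → ℕ) (i : Fin n) (a : Fin 2) : ℕ := if a = 0 then m i else 1

instance {n : ℕ} (m : Fin n → ℕ) [∀ i, NeZero (m i)] (i : Fin n) (a : Fin 2) :
    NeZero (cycleSize m i a) := by
  unfold cycleSize
  split_ifs <;> infer_instance

/-- Counts leaves modulo the cycle size, and moves to `1` exactly on state `i + 1`. -/
def counterDFA {n : ℕ} (m : Fin n → ℕ) (i : Fin n) (a : Fin 2) :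
    DFA (Fin n ⊕ Fin 2) (ZMod (cycleSize m i a)) where
  step s
    | Sum.inl q => if (q : ℕ) = i + 1 then 1 else 0
    | Sum.inr _ => s + 1
  start := 0
  accept := {s | s = 1 ∧ s ≠ 0}

/-- The horizontal languages of `counterDFA`. -/
def counterLang {n : ℕ} (m : Fin n → ℕ) (i : Fin n) (a : Fin 2) :
    Set (List (Fin n ⊕ Fin 2)) := (counterDFA m i a).accepts

/-- State `i` is reached by reading a word of leaves whose length is `1` modulo `m i`, or by a
unary node above a tree that reaches state `i + 1`. -/
def counterNTA {n : ℕ} (m : Fin n → ℕ) [∀ i, NeZero (m i)] : CNTAD (Fin 2) where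
  Q := Fin n
  S i a := ZMod (cycleSize m i a)
  finS _ _ := inferInstance
  H := counterDFA m
  F := {z | ∃ i : Fin n, (i : ℕ) = 0 ∧ z = Sum.inl i}
  noeps _ _ := fun h => h.2 rfl

namespace counterNTA

variable {n : ℕ} (m : Fin n → ℕ)

theorem vcard_eq [∀ i, NeZero (m i)] : (counterNTA m).vcard = n := Fintype.card_fin n

theorem hcard_eq [∀ i, NeZero (m i)] : (counterNTA m).hcard = ∑ i, m i + n := by
  have h : (counterNTA m).hcard =
      ∑ i : Fin n, ∑ a : Fin 2, Fintype.card (ZMod (cycleSize m i a)) := rfl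
  rw [h]
  simp only [ZMod.card]
  simp [cycleSize, Finset.sum_add_distrib]

theorem mem_counterLang_iff (i : Fin n) (a : Fin 2) (w : List (Fin n ⊕ Fin 2)) :
    w ∈ counterLang m i a ↔
      w.foldl (counterDFA m i a).step 0 = 1 ∧ w.foldl (counterDFA m i a).step 0 ≠ 0 :=
  Iff.rfl

theorem reach_one_leaf_iff (z : Fin n ⊕ Fin 2) :
    TReach (leafδ (counterLang m)) (UTree.node 1 []) z ↔ z = Sum.inr 1 := by
  rw [TReach.leaf_iff]
  cases z with
  | inl q => simp [leafδ, mem_counterLang_iff]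
  | inr b => simp [leafδ]

variable {m}

theorem foldl_replicate_inr (i : Fin n) (k : ℕ) (s : ZMod (cycleSize m i 0)) :
    (List.replicate k (Sum.inr 1)).foldl (counterDFA m i 0).step s = s + k := by
  induction k generalizing s with
  | zero => simp
  | succ k ih =>
    rw [List.replicate_succ, List.foldl_cons, ih]
    change (s + 1 + k : ZMod (cycleSize m i 0)) = _
    push_cast
    ring

theorem one_ne_zero_cycle (hm2 : ∀ i, 2 ≤ m i) (i : Fin n) :
    (1 : ZMod (cycleSize m i 0)) ≠ 0 := by
  have : Fact (1 < cycleSize m i 0) := ⟨hm2 i⟩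
  exact one_ne_zero

theorem reach_broom_iff (hm2 : ∀ i, 2 ≤ m i) (k : ℕ) (i : Fin n) :
    TReach (leafδ (counterLang m)) (broom k) (Sum.inl i) ↔ k ≡ 1 [MOD m i] := by
  rw [broom, TReach.replicate_iff (reach_one_leaf_iff m)]
  change _ ∈ counterLang m i 0 ↔ _
  rw [mem_counterLang_iff, foldl_replicate_inr, zero_add]
  have hc : ((k : ZMod (cycleSize m i 0)) = 1) ↔ k ≡ 1 [MOD m i] := by
    have h := ZMod.natCast_eq_natCast_iff k 1 (cycleSize m i 0)
    rwa [Nat.cast_one] at h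
  rw [← hc]
  exact ⟨And.left, fun h => ⟨h, h ▸ one_ne_zero_cycle hm2 i⟩⟩

theorem singleton_inl_mem_iff (hm2 : ∀ i, 2 ≤ m i) (p i : Fin n) :
    [Sum.inl p] ∈ leafδ (counterLang m) (Sum.inl i) 0 ↔ (p : ℕ) = i + 1 := by
  change _ ∈ counterLang m i 0 ↔ _
  rw [mem_counterLang_iff]
  change (if (p : ℕ) = i + 1 then (1 : ZMod (cycleSize m i 0)) else 0) = 1 ∧
    (if (p : ℕ) = i + 1 then (1 : ZMod (cycleSize m i 0)) else 0) ≠ 0 ↔ _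
  have := one_ne_zero_cycle hm2 i
  split_ifs with h <;> simp [h, this]

theorem not_reach_tower_inr {k : ℕ} (hk : k ≠ 0) (j : ℕ) (b : Fin 2) :
    ¬ TReach (leafδ (counterLang m)) (tower j (broom k)) (Sum.inr b) := by
  intro h
  cases j with
  | zero =>
    have h' := (TReach.replicate_iff (reach_one_leaf_iff m) k).1 h
    exact hk (List.replicate_eq_nil_iff _ |>.1 h'.2)
  | succ j =>
    rw [tower_succ, TReach.singleton_iff] at h
    obtain ⟨p, -, hp⟩ := h
    simp [leafδ] at hp

theorem reach_tower_broom_iff (hm2 : ∀ i, 2 ≤ m i) {k : ℕ} (hk : k ≠ 0) (j : ℕ) (i : Fin n) :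
    TReach (leafδ (counterLang m)) (tower j (broom k)) (Sum.inl i) ↔
      ∃ p : Fin n, (p : ℕ) = i + j ∧ k ≡ 1 [MOD m p] := by
  induction j generalizing i with
  | zero =>
    refine (reach_broom_iff hm2 k i).trans ⟨fun h => ⟨i, rfl, h⟩, ?_⟩
    rintro ⟨p, hp, h⟩
    rwa [← Fin.ext hp]
  | succ j ih =>
    rw [tower_succ, TReach.singleton_iff]
    constructor
    · rintro ⟨p | b, hp, hpi⟩
      · obtain ⟨r, hr, h⟩ := (ih p).1 hp
        have := (singleton_inl_mem_iff hm2 p i).1 hpi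
        exact ⟨r, by omega, h⟩
      · exact absurd hp (not_reach_tower_inr hk j b)
    · rintro ⟨r, hr, h⟩
      have hlt : (i : ℕ) + 1 < n := by have := r.2; omega
      refine ⟨Sum.inl ⟨i + 1, hlt⟩, (ih _).2 ⟨r, ?_, h⟩, (singleton_inl_mem_iff hm2 _ i).2 rfl⟩
      simp only
      omega

theorem tower_broom_mem_iff [∀ i, NeZero (m i)] (hm2 : ∀ i, 2 ≤ m i) {k : ℕ} (hk : k ≠ 0) (j : Fin n) :
    tower j (broom k) ∈ (counterNTA m).lang ↔ k ≡ 1 [MOD m j] := by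
  constructor
  · rintro ⟨_, ⟨i, hi, rfl⟩, h⟩
    obtain ⟨p, hp, h⟩ := (reach_tower_broom_iff hm2 hk j i).1 h
    rwa [show j = p from Fin.ext (by omega)]
  · intro h
    let z : Fin n := ⟨0, j.pos⟩
    exact ⟨Sum.inl z, ⟨z, rfl, rfl⟩,
      (reach_tower_broom_iff hm2 hk j z).2 ⟨j, by simp [z], h⟩⟩

end counterNTA

/-- The separation, with slightly sharper size bounds when `n` is at least `2`. -/
theorem exists_counter_language {n : ℕ} (m : Fin n → ℕ) (hm2 : ∀ i, 2 ≤ m i)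
    (hcop : ∀ i j, i ≠ j → Nat.Coprime (m i) (m j)) :
    ∃ A : CNTAD (Fin 2), A.vcard = n ∧ A.hcard = ∑ i, m i + n ∧
      ∀ B : CSDTA (Fin 2), B.lang = A.lang →
        2 ^ n - 1 ≤ B.vcard ∧ ∏ i, m i ≤ B.hcard := by
  have : ∀ i, NeZero (m i) := fun i => ⟨by have := hm2 i; omega⟩
  refine ⟨counterNTA m, counterNTA.vcard_eq m, counterNTA.hcard_eq m, fun B hB => ?_⟩
  have key : ∀ k, k ≠ 0 → ∀ i : Fin n,
      tower i (broom k) ∈ B.lang ↔ k ≡ 1 [MOD m i] := fun k hk i => by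
    rw [hB]
    exact counterNTA.tower_broom_mem_iff hm2 hk i
  exact ⟨B.two_pow_sub_one_le_vcard hm2 hcop key, B.prod_le_hcard hm2 hcop key⟩

/-- for pairwise relatively prime `2 ≤ m_1 < … < m_n` there is a
tree language `L` over a two-letter alphabet recognized by an NTA(DFA) with at
most `n` vertical and at most `(Σ m_i) + 2n − 2` horizontal states such that
every SDTA for `L` needs at least `2^n − 1` vertical and at least
`(∏ m_i) − 1` horizontal states. -/
theorem statement11 (n : ℕ) (hn : 1 ≤ n) (m : Fin n → ℕ)
    (hm2 : ∀ i, 2 ≤ m i) (hmono : StrictMono m)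
    (hcop : ∀ i j, i ≠ j → Nat.Coprime (m i) (m j)) :
    ∃ (L : Set (UTree (Fin 2))) (A : CNTAD (Fin 2)),
      A.lang = L ∧ A.vcard ≤ n ∧ A.hcard ≤ (∑ i, m i) + 2 * n - 2 ∧
      ∀ B : CSDTA (Fin 2), B.lang = L →
        2 ^ n - 1 ≤ B.vcard ∧ (∏ i, m i) - 1 ≤ B.hcard := by
  rcases Nat.lt_or_ge 1 n with h1 | h1
  · obtain ⟨A, hv, hh, hB⟩ := exists_counter_language m hm2 hcop
    refine ⟨A.lang, A, rfl, hv.le, by omega, fun B h => ⟨(hB B h).1, ?_⟩⟩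
    exact (Nat.sub_le _ _).trans (hB B h).2
  · obtain rfl : n = 1 := le_antisymm h1 hn
    have hm := hm2 0
    rcases hm.eq_or_lt with hm | hm
    · have : ∀ i : Fin 1, NeZero ((fun _ => 1 : Fin 1 → ℕ) i) := fun _ => ⟨one_ne_zero⟩
      let A := counterNTA (fun _ : Fin 1 => 1)
      have hA : A.hcard = 2 := by simp [A, counterNTA.hcard_eq]
      refine ⟨A.lang, A, rfl, (counterNTA.vcard_eq _).le, by simp [hA, ← hm], fun B _ => ?_⟩
      exact ⟨by simpa using B.one_le_vcard, by simpa [← hm] using B.one_le_hcard⟩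
    · obtain ⟨A, hv, hh, hB⟩ := exists_counter_language (fun i => m i - 1)
        (fun i => by rw [Subsingleton.elim i 0]; omega)
        (fun i j hij => absurd (Subsingleton.elim i j) hij)
      refine ⟨A.lang, A, rfl, hv.le, ?_, fun B h => ⟨(hB B h).1, by simpa using (hB B h).2⟩⟩
      simp only [Fin.sum_univ_one, Fin.isValue] at hh ⊢
      omega
end
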